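/- The stabiliser of the tuple (x_1, …, x_m) of free generators under the Hurwitz action of the braid group B_m on (F_m)^m is trivial. -/

import Mathlib

/-- The braid relators for the braid group on `k + 1` strands (with `k` standard
generators `σ_0, …, σ_{k-1}`). -/
def braidRels (k : ℕ) : Set (FreeGroup (Fin k)) :=
  {w | (∃ i j : Fin k, (i : ℕ) + 2 ≤ (j : ℕ) ∧
          w = FreeGroup.of i * FreeGroup.of j * (FreeGroup.of i)⁻¹ * (FreeGroup.of j)⁻¹) ∨
       (∃ i j : Fin k, (j : ℕ) = (i : ℕ) + 1 ∧
          w = FreeGroup.of i * FreeGroup.of j * FreeGroup.of i *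
                (FreeGroup.of j * FreeGroup.of i * FreeGroup.of j)⁻¹)}

/-- The braid group `B_{k+1}` on `k + 1` strands, presented by the standard generators
and braid relations. -/
abbrev BraidGroup (k : ℕ) := PresentedGroup (braidRels k)


namespace HurwitzFaithful

section Algebra

variable {B : Type*} [Group B]

/-- `t j = s (j-1) * ... * s 0` -/
def tt (s : ℕ → B) : ℕ → B
  | 0 => 1
  | j + 1 => s j * tt s j

/-- The generators of the free normal subgroup. -/
def aa (s : ℕ → B) (j : ℕ) : B := (tt s j)⁻¹ * (s j * s j) * tt s j

theorem tt_comm (s : ℕ → B)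
    (hc : ∀ i j, i + 2 ≤ j → s i * s j = s j * s i)
    (i j : ℕ) (h : j < i) : s i * tt s j = tt s j * s i := by
  induction j with
  | zero => simp [tt]
  | succ j ih =>
    have h1 := hc j i (by omega)
    have h2 := ih (by omega)
    simp only [tt]
    rw [← mul_assoc, ← h1, mul_assoc, h2, mul_assoc]

theorem tt_shift (s : ℕ → B) (n : ℕ)
    (hc : ∀ i j, i + 2 ≤ j → s i * s j = s j * s i)
    (hb : ∀ i, i + 1 < n → s i * s (i + 1) * s i = s (i + 1) * s i * s (i + 1))
    (i j : ℕ) (h : i + 1 < j) (hj : j ≤ n) :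
    s i * tt s j = tt s j * s (i + 1) := by
  induction j with
  | zero => omega
  | succ j ih =>
    rcases Nat.lt_or_ge (i + 1) j with h1 | h1
    · have h2 := ih h1 (by omega)
      have h3 := hc i j (by omega)
      simp only [tt]
      rw [← mul_assoc, h3, mul_assoc, h2, mul_assoc]
    · obtain rfl : j = i + 1 := by omega
      have h2 := tt_comm s hc (i + 1) i (by omega)
      have h3 := hb i (by omega)
      simp only [tt]
      rw [← mul_assoc, ← mul_assoc, h3, mul_assoc, h2]
      simp only [mul_assoc]

theorem s_tt_succ (s : ℕ → B) (i : ℕ) : s i * tt s (i + 1) = tt s i * aa s i := by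
  simp [tt, aa, mul_assoc]

theorem aa_comm (s : ℕ → B) (n : ℕ)
    (hc : ∀ i j, i + 2 ≤ j → s i * s j = s j * s i)
    (hb : ∀ i, i + 1 < n → s i * s (i + 1) * s i = s (i + 1) * s i * s (i + 1))
    (i j : ℕ) (h1 : 1 ≤ i) (hi : i < n) (hj : j < n) (h : i ≠ j) (h' : i ≠ j + 1) :
    s i * aa s j = aa s j * s i := by
  suffices ∃ c, c * tt s j = tt s j * s i ∧ c * s j = s j * c by
    obtain ⟨c, e1, e2⟩ := this
    have e1' : s i = (tt s j)⁻¹ * c * tt s j := by rw [mul_assoc, e1]; group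
    have e2' : c * (s j * s j) = s j * s j * c := by
      rw [← mul_assoc, e2, mul_assoc, e2, mul_assoc]
    rw [e1', aa]
    calc _ = (tt s j)⁻¹ * (c * (s j * s j)) * tt s j := by group
      _ = (tt s j)⁻¹ * (s j * s j * c) * tt s j := by rw [e2']
      _ = _ := by group
  rcases Nat.lt_or_ge i j with h2 | h2
  · obtain ⟨i, rfl⟩ : ∃ l, i = l + 1 := ⟨i - 1, by omega⟩
    exact ⟨s i, tt_shift s n hc hb i j h2 (by omega), hc _ _ (by omega)⟩
  · exact ⟨s i, tt_comm s hc i j (by omega), (hc _ _ (by omega)).symm⟩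

theorem aa_conj (s : ℕ → B) (n : ℕ)
    (hc : ∀ i j, i + 2 ≤ j → s i * s j = s j * s i)
    (hb : ∀ i, i + 1 < n → s i * s (i + 1) * s i = s (i + 1) * s i * s (i + 1))
    (i : ℕ) (hi : i + 1 < n) :
    s (i + 1) * aa s i = aa s (i + 1) * s (i + 1) := by
  have h1 := tt_comm s hc (i + 1) i (by omega)
  have h2 := hb i hi
  simp only [aa, tt]
  set p := s i
  set q := s (i + 1)
  set y := tt s i
  have h1' : q * y⁻¹ = y⁻¹ * q := by
    rw [mul_inv_eq_iff_eq_mul, mul_assoc, h1, inv_mul_cancel_left]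
  have h3 : p⁻¹ * q * q * p = q * p * p * q⁻¹ := by
    have e : p⁻¹ * q * p = q * p * q⁻¹ := by
      rw [eq_mul_inv_iff_mul_eq]
      have : p⁻¹ * (q * p * q) = q * p := by rw [← h2]; group
      rw [← this]; group
    calc _ = (p⁻¹ * q * p) * (p⁻¹ * q * p) := by group
      _ = _ := by rw [e]; group
  calc q * (y⁻¹ * (p * p) * y) = (q * y⁻¹) * (p * p) * y := by group
    _ = y⁻¹ * (q * p * p * q⁻¹) * (q * y) := by rw [h1']; group
    _ = y⁻¹ * (p⁻¹ * q * q * p) * (y * q) := by rw [h3, h1]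
    _ = _ := by group

theorem aa_conj' (s : ℕ → B) (n : ℕ)
    (hc : ∀ i j, i + 2 ≤ j → s i * s j = s j * s i)
    (hb : ∀ i, i + 1 < n → s i * s (i + 1) * s i = s (i + 1) * s i * s (i + 1))
    (i : ℕ) (hi : i + 1 < n) :
    s (i + 1) * (aa s i * aa s (i + 1)) = (aa s i * aa s (i + 1)) * s (i + 1) := by
  have h1 := tt_comm s hc (i + 1) i (by omega)
  have h2 := hb i hi
  have h0 := aa_conj s n hc hb i hi
  have h3 : aa s (i + 1) = s (i + 1) * aa s i * (s (i + 1))⁻¹ := by rw [h0]; group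
  rw [h3]
  simp only [aa]
  set p := s i
  set q := s (i + 1)
  set y := tt s i
  obtain ⟨q', hq⟩ : ∃ q', q' = y * q * y⁻¹ := ⟨_, rfl⟩
  have hq' : q' = q := by rw [hq, ← h1]; group
  have key : q * (p * p * q * (p * p)) = (p * p * q * (p * p)) * q := by
    have e1 : q * p * (p * q * p) = (p * q * p) * (p * q) := by
      calc q * p * (p * q * p) = q * p * (q * p * q) := by rw [h2]
        _ = (q * p * q) * (p * q) := by group
        _ = _ := by rw [← h2]
    calc q * (p * p * q * (p * p)) = q * p * (p * q * p) * p := by group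
      _ = (p * q * p) * (p * q) * p := by rw [e1]
      _ = p * (q * p) * (p * q * p) := by group
      _ = p * (q * p * (p * q * p)) := by group
      _ = p * ((p * q * p) * (p * q)) := by rw [e1]
      _ = _ := by group
  have hyq : y⁻¹ * q = q * y⁻¹ := by
    rw [eq_mul_inv_iff_mul_eq, mul_assoc, h1, inv_mul_cancel_left]
  have e : y⁻¹ * (p * p) * y * (q * (y⁻¹ * (p * p) * y) * q⁻¹)
      = y⁻¹ * (p * p * q * (p * p)) * y * q⁻¹ := by
    calc _ = y⁻¹ * (p * p) * (y * q) * (y⁻¹ * (p * p) * y) * q⁻¹ := by group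
      _ = y⁻¹ * (p * p) * (q * y) * (y⁻¹ * (p * p) * y) * q⁻¹ := by rw [h1]
      _ = _ := by group
  rw [e]
  calc _ = (q * y⁻¹) * (p * p * q * (p * p)) * y * q⁻¹ := by group
    _ = y⁻¹ * (q * (p * p * q * (p * p))) * y * q⁻¹ := by rw [← hyq]; group
    _ = y⁻¹ * (p * p * q * (p * p)) * (q * y) * q⁻¹ := by rw [key]; group
    _ = y⁻¹ * (p * p * q * (p * p)) * (y * q) * q⁻¹ := by rw [h1]
    _ = _ := by group

end Algebra

section Algebra2

variable {B : Type*} [Group B]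

/-- The hom from the free group. -/
def phi (s : ℕ → B) (n : ℕ) : FreeGroup (Fin n) →* B := FreeGroup.lift (fun j => aa s j)

theorem phi_of (s : ℕ → B) (n j : ℕ) (h : j < n) : phi s n (FreeGroup.of ⟨j, h⟩) = aa s j := by
  simp [phi]

theorem phi_conj_of_gen (s : ℕ → B) (n : ℕ) (c : B)
    (h : ∀ j, j < n → ∃ w, c * aa s j = phi s n w * c) (w : FreeGroup (Fin n)) :
    ∃ w', c * phi s n w = phi s n w' * c := by
  induction w using FreeGroup.induction_on with
  | C1 => exact ⟨1, by simp⟩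
  | of j =>
    obtain ⟨w, hw⟩ := h j j.2
    exact ⟨w, by rw [← hw, phi_of s n j j.2]⟩
  | inv_of j _ =>
    obtain ⟨w, hw⟩ := h j j.2
    refine ⟨w⁻¹, ?_⟩
    rw [map_inv, map_inv, phi_of s n j j.2, eq_inv_mul_iff_mul_eq, ← mul_assoc, ← hw,
      mul_inv_cancel_right]
  | mul x y hx hy =>
    obtain ⟨x', hx⟩ := hx
    obtain ⟨y', hy⟩ := hy
    refine ⟨x' * y', ?_⟩
    rw [map_mul, map_mul, ← mul_assoc, hx, mul_assoc, hy, mul_assoc]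

theorem phi_conj (s : ℕ → B) (n : ℕ)
    (hc : ∀ i j, i + 2 ≤ j → s i * s j = s j * s i)
    (hb : ∀ i, i + 1 < n → s i * s (i + 1) * s i = s (i + 1) * s i * s (i + 1))
    (i : ℕ) (h1 : 1 ≤ i) (hi : i < n) (w : FreeGroup (Fin n)) :
    ∃ w', s i * phi s n w = phi s n w' * s i := by
  refine phi_conj_of_gen s n _ (fun j hj => ?_) w
  by_cases hij : i = j + 1
  · subst hij
    exact ⟨FreeGroup.of ⟨j + 1, hi⟩, by rw [phi_of, aa_conj s n hc hb j hi]⟩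
  by_cases hij' : i = j
  · subst hij'
    obtain ⟨i, rfl⟩ : ∃ l, i = l + 1 := ⟨i - 1, by omega⟩
    have e1 := aa_conj s n hc hb i hi
    have e2 := aa_conj' s n hc hb i hi
    refine ⟨(FreeGroup.of ⟨i + 1, hi⟩)⁻¹ * FreeGroup.of ⟨i, by omega⟩ * FreeGroup.of ⟨i + 1, hi⟩, ?_⟩
    rw [map_mul, map_mul, map_inv, phi_of, phi_of]
    rw [mul_assoc, mul_assoc, eq_inv_mul_iff_mul_eq, ← mul_assoc (aa s i), ← e2, ← mul_assoc, ← e1,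
      mul_assoc]
  · exact ⟨FreeGroup.of ⟨j, hj⟩, by rw [phi_of, aa_comm s n hc hb i j h1 hi hj hij' hij]⟩

theorem phi_conj_inv (s : ℕ → B) (n : ℕ)
    (hc : ∀ i j, i + 2 ≤ j → s i * s j = s j * s i)
    (hb : ∀ i, i + 1 < n → s i * s (i + 1) * s i = s (i + 1) * s i * s (i + 1))
    (i : ℕ) (h1 : 1 ≤ i) (hi : i < n) (w : FreeGroup (Fin n)) :
    ∃ w', (s i)⁻¹ * phi s n w = phi s n w' * (s i)⁻¹ := by
  refine phi_conj_of_gen s n _ (fun j hj => ?_) w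
  by_cases hij : i = j + 1
  · subst hij
    have e1 := aa_conj s n hc hb j hi
    have e2 := aa_conj' s n hc hb j hi
    refine ⟨FreeGroup.of ⟨j, hj⟩ * FreeGroup.of ⟨j + 1, hi⟩ * (FreeGroup.of ⟨j, hj⟩)⁻¹, ?_⟩
    rw [map_mul, map_mul, map_inv, phi_of, phi_of]
    rw [inv_mul_eq_iff_eq_mul, ← mul_assoc, ← mul_assoc, e2, mul_assoc, mul_assoc, mul_assoc,
      ← mul_inv_rev, e1]
    group
  by_cases hij' : i = j
  · subst hij'
    obtain ⟨i, rfl⟩ : ∃ l, i = l + 1 := ⟨i - 1, by omega⟩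
    have e1 := aa_conj s n hc hb i hi
    refine ⟨FreeGroup.of ⟨i, by omega⟩, ?_⟩
    rw [phi_of, inv_mul_eq_iff_eq_mul, ← mul_assoc, e1, mul_inv_cancel_right]
  · refine ⟨FreeGroup.of ⟨j, hj⟩, ?_⟩
    rw [phi_of, inv_mul_eq_iff_eq_mul, ← mul_assoc,
      aa_comm s n hc hb i j h1 hi hj hij' hij, mul_inv_cancel_right]

/-- The elements of the form `t_j * φ w * β`. -/
def Good (s : ℕ → B) (n : ℕ) (K : Subgroup B) (b : B) : Prop :=
  ∃ j, j ≤ n ∧ ∃ w, ∃ c ∈ K, b = tt s j * phi s n w * c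

theorem good_mul (s : ℕ → B) (n : ℕ)
    (hc : ∀ i j, i + 2 ≤ j → s i * s j = s j * s i)
    (hb : ∀ i, i + 1 < n → s i * s (i + 1) * s i = s (i + 1) * s i * s (i + 1))
    (K : Subgroup B) (hK : ∀ i, 1 ≤ i → i < n → s i ∈ K) (i : ℕ) (hi : i < n)
    (b : B) (h : Good s n K b) : Good s n K (s i * b) := by
  obtain ⟨j, hj, w, c, hcK, rfl⟩ := h
  rw [← mul_assoc, ← mul_assoc]
  rcases lt_trichotomy i j with h1 | rfl | h1
  · rcases Nat.lt_or_ge (i + 1) j with h2 | h2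
    · obtain ⟨w', hw⟩ := phi_conj s n hc hb (i + 1) (by omega) (by omega) w
      refine ⟨j, hj, w', s (i + 1) * c, K.mul_mem (hK _ (by omega) (by omega)) hcK, ?_⟩
      rw [tt_shift s n hc hb i j h2 hj, mul_assoc (tt s j), hw]
      simp only [mul_assoc]
    · obtain rfl : j = i + 1 := by omega
      refine ⟨i, by omega, FreeGroup.of ⟨i, hi⟩ * w, c, hcK, ?_⟩
      rw [s_tt_succ, map_mul, phi_of]
      simp only [mul_assoc]
  · exact ⟨i + 1, hi, w, c, hcK, rfl⟩
  · obtain ⟨w', hw⟩ := phi_conj s n hc hb i (by omega) (by omega) w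
    refine ⟨j, hj, w', s i * c, K.mul_mem (hK _ (by omega) (by omega)) hcK, ?_⟩
    rw [tt_comm s hc i j h1, mul_assoc (tt s j), hw]
    simp only [mul_assoc]

theorem good_inv_mul (s : ℕ → B) (n : ℕ)
    (hc : ∀ i j, i + 2 ≤ j → s i * s j = s j * s i)
    (hb : ∀ i, i + 1 < n → s i * s (i + 1) * s i = s (i + 1) * s i * s (i + 1))
    (K : Subgroup B) (hK : ∀ i, 1 ≤ i → i < n → s i ∈ K) (i : ℕ) (hi : i < n)
    (b : B) (h : Good s n K b) : Good s n K ((s i)⁻¹ * b) := by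
  obtain ⟨j, hj, w, c, hcK, rfl⟩ := h
  rw [← mul_assoc, ← mul_assoc]
  have inv_swap : ∀ x y z : B, x * y = y * z → x⁻¹ * y = y * z⁻¹ := by
    intro x y z h
    rw [inv_mul_eq_iff_eq_mul, ← mul_assoc, h, mul_inv_cancel_right]
  rcases lt_trichotomy i j with h1 | rfl | h1
  · rcases Nat.lt_or_ge (i + 1) j with h2 | h2
    · obtain ⟨w', hw⟩ := phi_conj_inv s n hc hb (i + 1) (by omega) (by omega) w
      refine ⟨j, hj, w', (s (i + 1))⁻¹ * c,
        K.mul_mem (K.inv_mem (hK _ (by omega) (by omega))) hcK, ?_⟩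
      rw [inv_swap _ _ _ (tt_shift s n hc hb i j h2 hj), mul_assoc (tt s j), hw]
      simp only [mul_assoc]
    · obtain rfl : j = i + 1 := by omega
      refine ⟨i, by omega, w, c, hcK, ?_⟩
      simp [tt]
  · refine ⟨i + 1, hi, (FreeGroup.of ⟨i, hi⟩)⁻¹ * w, c, hcK, ?_⟩
    rw [map_mul, map_inv, phi_of, aa, tt]
    group
  · obtain ⟨w', hw⟩ := phi_conj_inv s n hc hb i (by omega) (by omega) w
    refine ⟨j, hj, w', (s i)⁻¹ * c, K.mul_mem (K.inv_mem (hK _ (by omega) (by omega))) hcK, ?_⟩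
    rw [inv_swap _ _ _ (tt_comm s hc i j h1), mul_assoc (tt s j), hw]
    simp only [mul_assoc]

end Algebra2

section Action

variable {G : Type*} [Group G]

/-- The elementary Hurwitz move. -/
def move {k : ℕ} (i : Fin k) : Equiv.Perm (Fin (k + 1) → G) where
  toFun g := Function.update
          (Function.update g i.castSucc (g i.castSucc * g i.succ * (g i.castSucc)⁻¹))
          i.succ (g i.castSucc)
  invFun g := Function.update
          (Function.update g i.castSucc (g i.succ))
          i.succ ((g i.succ)⁻¹ * g i.castSucc * g i.succ)
  left_inv g := by
    funext q
    have hne : i.castSucc ≠ i.succ := by simp [Fin.ext_iff]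
    by_cases h1 : q = i.succ
    · subst h1; simp [hne, mul_assoc]
    by_cases h2 : q = i.castSucc
    · subst h2; simp [hne]
    simp [h1, h2]
  right_inv g := by
    funext q
    have hne : i.castSucc ≠ i.succ := by simp [Fin.ext_iff]
    by_cases h1 : q = i.succ
    · subst h1; simp [hne]
    by_cases h2 : q = i.castSucc
    · subst h2; simp [hne, mul_assoc]
    simp [h1, h2]

theorem move_apply {k : ℕ} (i : Fin k) (g : Fin (k + 1) → G) (q : Fin (k + 1)) :
    move i g q = if q = i.succ then g i.castSucc else
      if q = i.castSucc then g i.castSucc * g i.succ * (g i.castSucc)⁻¹ else g q := by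
  simp [move, Function.update_apply]

theorem move_symm_apply {k : ℕ} (i : Fin k) (g : Fin (k + 1) → G) (q : Fin (k + 1)) :
    (move i).symm g q = if q = i.succ then (g i.succ)⁻¹ * g i.castSucc * g i.succ else
      if q = i.castSucc then g i.succ else g q := by
  simp [move, Function.update_apply]

theorem move_comm {k : ℕ} (i j : Fin k) (h : (i : ℕ) + 2 ≤ j) :
    (move i * move j : Equiv.Perm (Fin (k + 1) → G)) = move j * move i := by
  ext g q
  simp only [Equiv.Perm.mul_apply, move_apply, Fin.ext_iff, Fin.val_succ, Fin.val_castSucc]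
  split_ifs <;> first | omega | rfl

theorem move_braid {k : ℕ} (i j : Fin k) (h : (j : ℕ) = i + 1) :
    (move i * move j * move i : Equiv.Perm (Fin (k + 1) → G)) = move j * move i * move j := by
  ext g q
  have e : j.castSucc = i.succ := by simp [Fin.ext_iff, h]
  have h1 : i.castSucc ≠ i.succ := by simp [Fin.ext_iff]
  have h2 : j.succ ≠ i.succ := by simp [Fin.ext_iff]; omega
  have h3 : j.succ ≠ i.castSucc := by simp [Fin.ext_iff]; omega
  simp only [Equiv.Perm.mul_apply, move_apply, e, h1, h2, h3, h1.symm, h2.symm, h3.symm, if_true,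
    if_false]
  split_ifs <;> simp_all [mul_assoc]

/-- The Hurwitz action. -/
def hur (k : ℕ) (G : Type*) [Group G] : BraidGroup k →* Equiv.Perm (Fin (k + 1) → G) :=
  PresentedGroup.toGroup (f := fun i => move i) (by
    rintro r (⟨i, j, h, rfl⟩ | ⟨i, j, h, rfl⟩)
    · simp only [map_mul, map_inv, FreeGroup.lift_apply_of]
      rw [move_comm i j h]; group
    · simp only [map_mul, map_inv, FreeGroup.lift_apply_of]
      rw [move_braid i j h]; group)

theorem hur_of {k : ℕ} (i : Fin k) : hur k G (PresentedGroup.of i) = move i := by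
  simp [hur]

theorem hur_nat {k : ℕ} {G' : Type*} [Group G'] (f : G →* G') (b : BraidGroup k)
    (g : Fin (k + 1) → G) : hur k G' b (f ∘ g) = f ∘ hur k G b g := by
  have hb : b ∈ Subgroup.closure (Set.range (PresentedGroup.of (rels := braidRels k))) := by
    rw [PresentedGroup.closure_range_of]; trivial
  induction hb using Subgroup.closure_induction generalizing g with
  | mem x hx =>
    obtain ⟨i, rfl⟩ := hx
    rw [hur_of, hur_of]
    funext q
    simp only [move_apply, Function.comp]
    split_ifs <;> simp
  | one => simp
  | mul x y _ _ hx hy =>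
    rw [map_mul, map_mul, Equiv.Perm.mul_apply, Equiv.Perm.mul_apply, hy, hx]
  | inv x _ hx =>
    rw [map_inv, map_inv, Equiv.Perm.inv_eq_iff_eq, hx, ← Equiv.Perm.mul_apply, mul_inv_cancel]
    rfl

/-- The shift embedding. -/
def shift (k : ℕ) : BraidGroup k →* BraidGroup (k + 1) :=
  PresentedGroup.toGroup (f := fun i => PresentedGroup.of i.succ) (by
    rintro r (⟨i, j, h, rfl⟩ | ⟨i, j, h, rfl⟩)
    · simp only [map_mul, map_inv, FreeGroup.lift_apply_of]
      refine PresentedGroup.one_of_mem (rels := braidRels (k + 1)) (Or.inl ⟨i.succ, j.succ, ?_, rfl⟩)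
      simp; omega
    · simp only [map_mul, map_inv, FreeGroup.lift_apply_of]
      refine PresentedGroup.one_of_mem (rels := braidRels (k + 1)) (Or.inr ⟨i.succ, j.succ, ?_, rfl⟩)
      simp; omega)

theorem shift_of {k : ℕ} (i : Fin k) : shift k (PresentedGroup.of i) = PresentedGroup.of i.succ := by
  simp [shift]

theorem hur_shift {k : ℕ} (b : BraidGroup k) (v : G) (g : Fin (k + 1) → G) :
    hur (k + 1) G (shift k b) (Fin.cons v g : Fin (k + 2) → G) = Fin.cons v (hur k G b g) := by
  have hb : b ∈ Subgroup.closure (Set.range (PresentedGroup.of (rels := braidRels k))) := by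
    rw [PresentedGroup.closure_range_of]; trivial
  induction hb using Subgroup.closure_induction generalizing g with
  | mem x hx =>
    obtain ⟨i, rfl⟩ := hx
    rw [shift_of, hur_of, hur_of]
    funext q
    refine Fin.cases ?_ (fun q => ?_) q
    · simp [move_apply, Fin.ext_iff]
    · have : i.succ.castSucc = i.castSucc.succ := rfl
      simp [move_apply, this]
  | one => simp
  | mul x y _ _ hx hy =>
    simp only [map_mul, Equiv.Perm.mul_apply, hy, hx]
  | inv x _ hx =>
    rw [map_inv, map_inv, map_inv, Equiv.Perm.inv_eq_iff_eq, hx, ← Equiv.Perm.mul_apply,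
      mul_inv_cancel]
    rfl

/-- natural-number indexed generators -/
def sg (n : ℕ) (i : ℕ) : BraidGroup n := if h : i < n then PresentedGroup.of ⟨i, h⟩ else 1

theorem sg_fin {n : ℕ} (i : Fin n) : sg n i = PresentedGroup.of i := by simp [sg]

theorem sg_comm (n i j : ℕ) (h : i + 2 ≤ j) : sg n i * sg n j = sg n j * sg n i := by
  by_cases hj : j < n
  · have hi : i < n := by omega
    have := PresentedGroup.one_of_mem (rels := braidRels n) (Or.inl ⟨⟨i, hi⟩, ⟨j, hj⟩, h, rfl⟩)
    simp only [map_mul, map_inv] at this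
    simp only [sg, hi, hj, dif_pos]
    rw [mul_inv_eq_one, mul_inv_eq_iff_eq_mul] at this
    exact this
  · simp [sg, hj]

theorem sg_braid (n i : ℕ) (h : i + 1 < n) :
    sg n i * sg n (i + 1) * sg n i = sg n (i + 1) * sg n i * sg n (i + 1) := by
  have hi : i < n := by omega
  have := PresentedGroup.one_of_mem (rels := braidRels n) (Or.inr ⟨⟨i, hi⟩, ⟨i + 1, h⟩, rfl, rfl⟩)
  simp only [map_mul, map_inv] at this
  simp only [sg, hi, h, dif_pos]
  rw [mul_inv_eq_one] at this
  exact this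

theorem good_all (k : ℕ) (b : BraidGroup (k + 1)) :
    Good (sg (k + 1)) (k + 1) (shift k).range b := by
  have hK : ∀ i, 1 ≤ i → i < k + 1 → sg (k + 1) i ∈ (shift k).range := by
    intro i h1 h2
    obtain ⟨i, rfl⟩ : ∃ l, i = l + 1 := ⟨i - 1, by omega⟩
    refine ⟨PresentedGroup.of ⟨i, by omega⟩, ?_⟩
    rw [shift_of]
    simp [sg, h2]
  have hb : b ∈ Subgroup.closure (Set.range (PresentedGroup.of (rels := braidRels (k + 1)))) := by
    rw [PresentedGroup.closure_range_of]; trivial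
  induction hb using Subgroup.closure_induction_left with
  | one => exact ⟨0, by omega, 1, 1, Subgroup.one_mem _, by simp [tt]⟩
  | mul_left x hx y _ hy =>
    obtain ⟨i, rfl⟩ := hx
    rw [← sg_fin]
    exact good_mul _ _ (sg_comm _) (sg_braid _) _ hK i i.2 _ hy
  | inv_mul_cancel x hx y _ hy =>
    obtain ⟨i, rfl⟩ := hx
    rw [← sg_fin]
    exact good_inv_mul _ _ (sg_comm _) (sg_braid _) _ hK i i.2 _ hy

end Action

section Final

variable {G : Type*} [Group G] {n : ℕ}

theorem hur_sg (i : Fin n) : hur n G (sg n i) = move i := by rw [sg_fin, hur_of]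

theorem move_ins (z : G) (hz : ∀ x, z * x = x * z) (i : Fin n) (g : Fin n → G) :
    move i (i.castSucc.insertNth z g : Fin (n + 1) → G) = (i.succ.insertNth z g) ∧
    move i (i.succ.insertNth z g : Fin (n + 1) → G) = (i.castSucc.insertNth z g) := by
  have e1 : i.castSucc.succAbove i = i.succ := Fin.succAbove_castSucc_self i
  have e2 : i.succ.succAbove i = i.castSucc := Fin.succAbove_succ_self i
  have a1 : (i.castSucc.insertNth z g : Fin (n + 1) → G) i.castSucc = z := by simp
  have a2 : (i.castSucc.insertNth z g : Fin (n + 1) → G) i.succ = g i := by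
    rw [← e1]; exact Fin.insertNth_apply_succAbove (α := fun _ => G) _ _ _ _
  have b1 : (i.succ.insertNth z g : Fin (n + 1) → G) i.succ = z := by simp
  have b2 : (i.succ.insertNth z g : Fin (n + 1) → G) i.castSucc = g i := by
    conv_lhs => rw [← e2]
    exact Fin.insertNth_apply_succAbove (α := fun _ => G) _ _ _ _
  have e3 : ∀ q, q ≠ i.castSucc → q ≠ i.succ → (i.castSucc.insertNth z g : Fin (n + 1) → G) q =
      (i.succ.insertNth z g : Fin (n + 1) → G) q := by
    intro q h1 h2
    obtain ⟨l, rfl⟩ := Fin.exists_succAbove_eq h1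
    have hl : l ≠ i := by rintro rfl; exact h2 e1
    have e4 : i.castSucc.succAbove l = i.succ.succAbove l := by
      rcases lt_or_gt_of_ne hl with h | h
      · rw [Fin.succAbove_castSucc_of_lt _ _ h, Fin.succAbove_succ_of_le _ _ h.le]
      · rw [Fin.succAbove_castSucc_of_le _ _ h.le, Fin.succAbove_succ_of_lt _ _ h]
    conv_rhs => rw [e4]
    rw [Fin.insertNth_apply_succAbove, Fin.insertNth_apply_succAbove]
  constructor
  · funext q
    rw [move_apply, a1, a2]
    split_ifs with h1 h2
    · rw [h1, b1]
    · rw [h2, b2, hz, mul_inv_cancel_right]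
    · exact e3 q h2 h1
  · funext q
    rw [move_apply, b1, b2]
    split_ifs with h1 h2
    · rw [h1, a2]
    · rw [h2, a1, ← hz, mul_inv_cancel_right]
    · exact (e3 q h2 h1).symm

theorem hur_tt_ins (z : G) (hz : ∀ x, z * x = x * z) (g : Fin n → G) (j : ℕ) (hj : j < n + 1) :
    hur n G (tt (sg n) j) ((0 : Fin (n + 1)).insertNth z g : Fin (n + 1) → G) =
      (⟨j, hj⟩ : Fin (n + 1)).insertNth z g := by
  induction j with
  | zero => simp [tt]
  | succ j ih =>
    have h := ih (by omega)
    rw [tt, map_mul, Equiv.Perm.mul_apply, h, hur_sg ⟨j, by omega⟩]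
    exact (move_ins z hz ⟨j, by omega⟩ g).1

theorem hur_aa_ins (z : G) (hz : ∀ x, z * x = x * z) (g : Fin n → G) (j : Fin n) :
    hur n G (aa (sg n) j) ((0 : Fin (n + 1)).insertNth z g : Fin (n + 1) → G) =
      (0 : Fin (n + 1)).insertNth z g := by
  have h := hur_tt_ins z hz g j (by omega)
  have h1 : (⟨(j : ℕ), by omega⟩ : Fin (n + 1)) = j.castSucc := rfl
  rw [aa, map_mul, map_mul, map_mul, map_inv, Equiv.Perm.mul_apply, Equiv.Perm.mul_apply,
    Equiv.Perm.mul_apply, Equiv.Perm.inv_eq_iff_eq, h, hur_sg, h1, (move_ins z hz j g).1,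
    (move_ins z hz j g).2]

theorem hur_phi_ins (z : G) (hz : ∀ x, z * x = x * z) (g : Fin n → G) (u : FreeGroup (Fin n)) :
    hur n G (phi (sg n) n u) ((0 : Fin (n + 1)).insertNth z g : Fin (n + 1) → G) =
      (0 : Fin (n + 1)).insertNth z g := by
  induction u using FreeGroup.induction_on with
  | C1 => simp
  | of j => rw [phi_of _ _ _ j.2, hur_aa_ins z hz]
  | inv_of j _ =>
    rw [map_inv, map_inv, Equiv.Perm.inv_eq_iff_eq, phi_of _ _ _ j.2, hur_aa_ins z hz]
  | mul x y hx hy => rw [map_mul, map_mul, Equiv.Perm.mul_apply, hy, hx]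

variable {F : Type*} [Group F]

/-- The state predicate. -/
def St (π : G →* F) (δ : G) (y : Fin n → F) (p : Fin (n + 1)) (w : F) (g : Fin (n + 1) → G) :
    Prop :=
  (∃ c, g p = c * δ * c⁻¹ ∧ π c = w) ∧ ∀ i, π (g (p.succAbove i)) = y i

theorem succAbove_cases (i l : Fin n) (hl : l ≠ i) :
    i.castSucc.succAbove l = i.succ.succAbove l ∧ i.succ.succAbove l ≠ i.castSucc ∧
      i.succ.succAbove l ≠ i.succ := by
  refine ⟨?_, ?_, Fin.succAbove_ne _ _⟩
  · rcases lt_or_gt_of_ne hl with h | h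
    · rw [Fin.succAbove_castSucc_of_lt _ _ h, Fin.succAbove_succ_of_le _ _ h.le]
    · rw [Fin.succAbove_castSucc_of_le _ _ h.le, Fin.succAbove_succ_of_lt _ _ h]
  · intro h
    have e2 : i.succ.succAbove i = i.castSucc := Fin.succAbove_succ_self i
    rw [← e2] at h
    exact hl (Fin.succAbove_right_injective h)

theorem st_right (π : G →* F) (δ : G) (hδ : π δ = 1) (y : Fin n → F)
    (i : Fin n) (w : F) (g : Fin (n + 1) → G) (h : St π δ y i.castSucc w g) :
    St π δ y i.succ w (move i g) := by
  obtain ⟨⟨c, hc, hw⟩, h⟩ := h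
  have hi := h i
  rw [Fin.succAbove_castSucc_self] at hi
  refine ⟨⟨c, by simp [move_apply, hc], hw⟩, fun l => ?_⟩
  by_cases hl : l = i
  · subst hl
    have hne : l.castSucc ≠ l.succ := by simp [Fin.ext_iff]
    rw [Fin.succAbove_succ_self]
    simp [move_apply, hne, hc, hδ, hi]
  · obtain ⟨e1, e2, e3⟩ := succAbove_cases i l hl
    rw [move_apply, if_neg e3, if_neg e2, ← e1, h]

theorem st_left (π : G →* F) (δ : G) (hδ : π δ = 1) (y : Fin n → F)
    (i : Fin n) (w : F) (g : Fin (n + 1) → G) (h : St π δ y i.succ w g) :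
    St π δ y i.castSucc (y i * w) (move i g) := by
  obtain ⟨⟨c, hc, hw⟩, h⟩ := h
  have hi := h i
  have hne : i.castSucc ≠ i.succ := by simp [Fin.ext_iff]
  rw [Fin.succAbove_succ_self] at hi
  refine ⟨⟨g i.castSucc * c, by simp [move_apply, hc, hne, mul_assoc], by simp [hi, hw]⟩,
    fun l => ?_⟩
  by_cases hl : l = i
  · subst hl
    rw [Fin.succAbove_castSucc_self]
    simp [move_apply, hi]
  · obtain ⟨e1, e2, e3⟩ := succAbove_cases i l hl
    rw [e1, move_apply, if_neg e3, if_neg e2, h]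

theorem st_right_inv (π : G →* F) (δ : G) (hδ : π δ = 1) (y : Fin n → F)
    (i : Fin n) (w : F) (g : Fin (n + 1) → G) (h : St π δ y i.succ w g) :
    St π δ y i.castSucc w ((move i).symm g) := by
  obtain ⟨⟨c, hc, hw⟩, h⟩ := h
  have hi := h i
  have hne : i.castSucc ≠ i.succ := by simp [Fin.ext_iff]
  rw [Fin.succAbove_succ_self] at hi
  refine ⟨⟨c, by simp [move_symm_apply, hc, hne], hw⟩, fun l => ?_⟩
  by_cases hl : l = i
  · subst hl
    rw [Fin.succAbove_castSucc_self]
    simp [move_symm_apply, hc, hδ, hi]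
  · obtain ⟨e1, e2, e3⟩ := succAbove_cases i l hl
    rw [e1, move_symm_apply, if_neg e3, if_neg e2, h]

theorem st_left_inv (π : G →* F) (δ : G) (hδ : π δ = 1) (y : Fin n → F)
    (i : Fin n) (w : F) (g : Fin (n + 1) → G) (h : St π δ y i.castSucc w g) :
    St π δ y i.succ ((y i)⁻¹ * w) ((move i).symm g) := by
  obtain ⟨⟨c, hc, hw⟩, h⟩ := h
  have hi := h i
  have hne : i.castSucc ≠ i.succ := by simp [Fin.ext_iff]
  rw [Fin.succAbove_castSucc_self] at hi
  refine ⟨⟨(g i.succ)⁻¹ * c, by simp [move_symm_apply, hc, mul_assoc], by simp [hi, hw]⟩,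
    fun l => ?_⟩
  by_cases hl : l = i
  · subst hl
    rw [Fin.succAbove_succ_self]
    simp [move_symm_apply, hi, hne]
  · obtain ⟨e1, e2, e3⟩ := succAbove_cases i l hl
    rw [move_symm_apply, if_neg e3, if_neg e2, ← e1, h]

theorem st_tt (π : G →* F) (δ : G) (hδ : π δ = 1) (y : Fin n → F)
    (j : ℕ) (hj : j < n + 1) (w : F) (g : Fin (n + 1) → G) (h : St π δ y 0 w g) :
    St π δ y ⟨j, hj⟩ w (hur n G (tt (sg n) j) g) := by
  induction j with
  | zero => simpa [tt] using h
  | succ j ih =>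
    rw [tt, map_mul, Equiv.Perm.mul_apply, hur_sg ⟨j, by omega⟩]
    exact st_right π δ hδ y ⟨j, by omega⟩ w _ (ih (by omega))

theorem st_tt_inv (π : G →* F) (δ : G) (hδ : π δ = 1) (y : Fin n → F)
    (j : ℕ) (hj : j < n + 1) (w : F) (g : Fin (n + 1) → G)
    (h : St π δ y ⟨j, hj⟩ w g) : St π δ y 0 w ((hur n G (tt (sg n) j))⁻¹ g) := by
  induction j generalizing g with
  | zero => simpa [tt] using h
  | succ j ih =>
    rw [tt, map_mul, mul_inv_rev, Equiv.Perm.mul_apply, hur_sg ⟨j, by omega⟩]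
    exact ih (by omega) _ (st_right_inv π δ hδ y ⟨j, by omega⟩ w _ h)

theorem st_aa (π : G →* F) (δ : G) (hδ : π δ = 1) (y : Fin n → F)
    (j : Fin n) (w : F) (g : Fin (n + 1) → G) (h : St π δ y 0 w g) :
    St π δ y 0 (y j * w) (hur n G (aa (sg n) j) g) := by
  have h1 := st_tt π δ hδ y j (by omega) w g h
  have h2 := st_left π δ hδ y j _ _ (st_right π δ hδ y j _ _ h1)
  have h3 := st_tt_inv π δ hδ y j (by omega) _ _ h2
  rw [aa, map_mul, map_mul, map_mul, map_inv, hur_sg]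
  exact h3

theorem st_aa_inv (π : G →* F) (δ : G) (hδ : π δ = 1) (y : Fin n → F)
    (j : Fin n) (w : F) (g : Fin (n + 1) → G) (h : St π δ y 0 w g) :
    St π δ y 0 ((y j)⁻¹ * w) ((hur n G (aa (sg n) j))⁻¹ g) := by
  have h1 := st_tt π δ hδ y j (by omega) w g h
  have h2 := st_right_inv π δ hδ y j _ _ (st_left_inv π δ hδ y j _ _ h1)
  have h3 := st_tt_inv π δ hδ y j (by omega) _ _ h2
  rw [aa, map_mul, map_mul, map_mul, map_inv, hur_sg]
  simp only [mul_inv_rev, inv_inv]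
  exact h3

theorem st_phi (π : G →* F) (δ : G) (hδ : π δ = 1) (y : Fin n → F)
    (u : FreeGroup (Fin n)) (w : F) (g : Fin (n + 1) → G) (h : St π δ y 0 w g) :
    St π δ y 0 (FreeGroup.lift y u * w) (hur n G (phi (sg n) n u) g) := by
  induction u using FreeGroup.induction_on generalizing w g with
  | C1 => simpa using h
  | of j =>
    rw [phi_of _ _ _ j.2, FreeGroup.lift_apply_of]
    exact st_aa π δ hδ y j w g h
  | inv_of j _ =>
    rw [map_inv, map_inv, map_inv, phi_of _ _ _ j.2, FreeGroup.lift_apply_of]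
    exact st_aa_inv π δ hδ y j w g h
  | mul a b ha hb =>
    rw [map_mul, map_mul, map_mul, mul_assoc, Equiv.Perm.mul_apply]
    exact ha _ _ (hb _ _ h)

theorem phi_trivial (n : ℕ) (u : FreeGroup (Fin n))
    (h : ∀ (G : Type) [Group G] (g : Fin (n + 1) → G), hur n G (phi (sg n) n u) g = g) :
    u = 1 := by
  classical
  let D := Multiplicative ℤ
  let Q := FreeGroup (Fin n)
  let W := RegularWreathProduct D Q
  let d : D := Multiplicative.ofAdd 1
  let δ : W := ⟨Pi.mulSingle 1 d, 1⟩
  let π : W →* Q := RegularWreathProduct.rightHom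
  let g : Fin (n + 1) → W := Fin.cons δ (fun i => RegularWreathProduct.inl (FreeGroup.of i))
  have h0 : St π δ (fun i => FreeGroup.of i) 0 1 g := by
    refine ⟨⟨1, by simp [g], by simp⟩, fun i => ?_⟩
    simp only [g, Fin.zero_succAbove, Fin.cons_succ]
    rfl
  have h1 := st_phi π δ rfl _ u _ _ h0
  rw [h W g] at h1
  obtain ⟨⟨c, hc, hw⟩, -⟩ := h1
  have hw' : c.right = u := by
    have e : FreeGroup.lift (fun i : Fin n => FreeGroup.of i) u = u := by
      have : FreeGroup.lift (fun i : Fin n => FreeGroup.of i) = MonoidHom.id _ := by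
        ext; simp
      rw [this]; rfl
    rw [e, mul_one] at hw
    exact hw
  have hc' : δ * c = c * δ := by
    have : δ = c * δ * c⁻¹ := hc
    exact eq_mul_inv_iff_mul_eq.mp this
  have h2 := congrFun (congrArg RegularWreathProduct.left hc') c.right
  rw [hw'] at h2
  have h2 : (Pi.mulSingle 1 d : Q → D) u * c.left (1⁻¹ * u) =
    c.left u * (Pi.mulSingle 1 d : Q → D) (c.right⁻¹ * u) := h2
  rw [hw'] at h2
  simp only [inv_one, one_mul, inv_mul_cancel, Pi.mulSingle_eq_same] at h2
  rw [mul_comm] at h2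
  have h3 := mul_left_cancel h2
  by_contra hu
  rw [Pi.mulSingle_eq_of_ne hu] at h3
  have h4 : (0 : ℤ) = 1 := h3
  omega

theorem main (k : ℕ) : ∀ b : BraidGroup k,
    (∀ (G : Type) [Group G] (g : Fin (k + 1) → G), hur k G b g = g) → b = 1 := by
  induction k with
  | zero =>
    intro b _
    induction b using PresentedGroup.induction_on with
    | _ z => rw [Subsingleton.elim z 1, map_one]
  | succ k ih =>
    intro b hb
    obtain ⟨j, hj, u, c, ⟨β, rfl⟩, rfl⟩ := good_all k b
    have act : ∀ (G : Type) [Group G] (z : G) (hz : ∀ x, z * x = x * z) (g : Fin (k + 1) → G),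
        (⟨j, by omega⟩ : Fin (k + 2)).insertNth z (hur k G β g) =
          (Fin.cons z g : Fin (k + 2) → G) := by
      intro G _ z hz g
      have h := hb G (Fin.cons z g)
      rw [map_mul, map_mul, Equiv.Perm.mul_apply, Equiv.Perm.mul_apply, hur_shift,
        ← Fin.insertNth_zero', hur_phi_ins z hz, hur_tt_ins z hz _ j (by omega)] at h
      exact h
    have hj0 : j = 0 := by
      by_contra hne
      let z : Multiplicative ℤ := Multiplicative.ofAdd 1
      have h := act (Multiplicative ℤ) z (fun x => mul_comm _ _) 1
      have h1 := congrFun h ⟨j, by omega⟩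
      obtain ⟨l, rfl⟩ : ∃ l, j = l + 1 := ⟨j - 1, by omega⟩
      rw [Fin.insertNth_apply_same] at h1
      have h4 : (1 : ℤ) = 0 := h1
      omega
    subst hj0
    have hβ : β = 1 := by
      apply ih
      intro G _ g
      have h := act G 1 (by simp) g
      have h0 : (⟨0, by omega⟩ : Fin (k + 2)) = 0 := rfl
      rw [h0, Fin.insertNth_zero'] at h
      exact (Fin.cons_injective2 h).2
    subst hβ
    simp only [tt, map_one, one_mul, mul_one] at hb ⊢
    rw [phi_trivial _ u hb, map_one]

end Final

end HurwitzFaithful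

/-- The stabiliser of the tuple `(x_1, …, x_m)` of free generators under the Hurwitz action of
the braid group `B_m` on `m`-tuples of elements of the free group `F_m` is trivial.
Here `m = k + 1`, and the Hurwitz action is encoded by any homomorphism `A` from `B_m` to the
permutations of `m`-tuples sending the standard generator `σ_i` to the elementary Hurwitz move
`(g_1, …, g_i, g_{i+1}, …) ↦ (g_1, …, g_i g_{i+1} g_i⁻¹, g_i, …)`. -/
theorem stmt_3 (k : ℕ)
    (A : BraidGroup k →* Equiv.Perm (Fin (k + 1) → FreeGroup (Fin (k + 1))))
    (hA : ∀ (i : Fin k) (g : Fin (k + 1) → FreeGroup (Fin (k + 1))),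
      A (PresentedGroup.of i) g =
        Function.update
          (Function.update g i.castSucc (g i.castSucc * g i.succ * (g i.castSucc)⁻¹))
          i.succ (g i.castSucc)) :
    ∀ b : BraidGroup k,
      A b (fun i => FreeGroup.of i) = (fun i => FreeGroup.of i) → b = 1 := by
  intro b hb
  have hAe : A = HurwitzFaithful.hur k (FreeGroup (Fin (k + 1))) := by
    apply PresentedGroup.ext
    intro i
    rw [HurwitzFaithful.hur_of]
    ext1 g
    rw [hA]
    rfl
  subst hAe
  refine HurwitzFaithful.main k b (fun G _ g => ?_)
  have h := HurwitzFaithful.hur_nat (FreeGroup.lift g) b (fun i => FreeGroup.of i)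
  rw [hb] at h
  have e : (FreeGroup.lift g) ∘ (fun i => FreeGroup.of i) = g := by
    funext i
    simp
  rw [e] at h
  exact h
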